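/- arXiv:1301.4456 — 3 statements merged into one kernel-verified Lean document; each statement's English description precedes it below -/
import Mathlib

section
/- Let (X,d) be a metric space with marked point p. The inequality ρ²(α,β)+ρ²(γ,η) ≤ ρ²(α,γ)+ρ²(α,η)+ρ²(β,γ)+ρ²(β,η) holds for every pretangent space Ω_{p,r̃}^X (over all normalizing sequences r̃ and all maximal self-stable families) and all points α,β,γ,η ∈ Ω_{p,r̃}^X if and only if liminf_{w,x,y,z→p} A₁(w,x,y,z) ≥ 0. -/
open Filter Topology

universe u

section Defs

variable {X : Type u} [MetricSpace X]

/-- A normalizing sequence is a sequence of positive reals tending to zero. -/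
def IsNormalizingSeq (r : ℕ → ℝ) : Prop :=
  (∀ n, 0 < r n) ∧ Tendsto r atTop (𝓝 0)

/-- Two sequences of points of `X` are mutually stable w.r.t. `r` if
`d(x_n, y_n)/r_n` converges to a finite limit. -/
def MutuallyStable (r : ℕ → ℝ) (x y : ℕ → X) : Prop :=
  ∃ L : ℝ, Tendsto (fun n => dist (x n) (y n) / r n) atTop (𝓝 L)

/-- A family of sequences is self-stable if any two members are mutually stable. -/
def SelfStable (r : ℕ → ℝ) (F : Set (ℕ → X)) : Prop :=
  ∀ x ∈ F, ∀ y ∈ F, MutuallyStable r x y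

/-- A maximal self-stable family containing the constant sequence `p`. -/
def MaximalSelfStable (p : X) (r : ℕ → ℝ) (F : Set (ℕ → X)) : Prop :=
  SelfStable r F ∧ (fun _ => p) ∈ F ∧
    ∀ G : Set (ℕ → X), SelfStable r G → F ⊆ G → G = F

/-- `(Ω, π)` is (a realization of) the pretangent space of `X` at `p`
with respect to the normalizing sequence `r` and the maximal self-stable family
`F`; the map `π` is the metric identification projection, so that the distance
in `Ω` between `π x` and `π y` is `lim_n d(x_n,y_n)/r_n`. -/
def IsPretangentSpace (p : X) (r : ℕ → ℝ) (F : Set (ℕ → X))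
    {Ω : Type u} [MetricSpace Ω] (π : (ℕ → X) → Ω) : Prop :=
  IsNormalizingSeq r ∧ MaximalSelfStable p r F ∧
    (∀ ω : Ω, ∃ x ∈ F, π x = ω) ∧
    ∀ x ∈ F, ∀ y ∈ F,
      Tendsto (fun n => dist (x n) (y n) / r n) atTop (𝓝 (dist (π x) (π y)))

/-- The pretangent space determined by the maximal self-stable family `F` is
tangent: for every strictly increasing sequence `φ` of naturals and every
maximal self-stable family `F'` w.r.t. `r ∘ φ` containing all `x ∘ φ` with
`x ∈ F`, the canonical isometric embedding `em'` is bijective (being always an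
isometric embedding it suffices that it be surjective, as stated here). -/
def IsTangentFamily (p : X) (r : ℕ → ℝ) (F : Set (ℕ → X)) : Prop :=
  ∀ φ : ℕ → ℕ, StrictMono φ →
    ∀ F' : Set (ℕ → X), MaximalSelfStable p (r ∘ φ) F' →
      (∀ x ∈ F, x ∘ φ ∈ F') →
      ∀ y ∈ F', ∃ x ∈ F,
        Tendsto (fun k => dist (x (φ k)) (y k) / r (φ k)) atTop (𝓝 0)

/-- `δ_p(w,x,y,z) = max_i d(x_i, p)`. -/
noncomputable def delta4 (p w x y z : X) : ℝ :=
  max (dist w p) (max (dist x p) (max (dist y p) (dist z p)))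

/-- `δ_p(x,y,z) = max_i d(x_i, p)`. -/
noncomputable def delta3 (p x y z : X) : ℝ :=
  max (dist x p) (max (dist y p) (dist z p))

open Classical in
/-- The function `A₁` of Berg–Nikolaev type. -/
noncomputable def A1 (p w x y z : X) : ℝ :=
  if w = p ∧ x = p ∧ y = p ∧ z = p then 0
  else (dist w x ^ 2 + dist x y ^ 2 + dist y z ^ 2 + dist z w ^ 2
          - dist w y ^ 2 - dist x z ^ 2) / delta4 p w x y z ^ 2

open Classical in
/-- The function `A₂` of Lebedeva–Petrunin type. -/
noncomputable def A2 (p w x y z : X) : ℝ :=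
  if w = p ∧ x = p ∧ y = p ∧ z = p then 0
  else (dist w x ^ 2 + dist w y ^ 2 + dist w z ^ 2
          - (dist x y ^ 2 + dist y z ^ 2 + dist z x ^ 2) / 3) / delta4 p w x y z ^ 2

open Classical in
/-- The function `A₃` of Ptolemy type. -/
noncomputable def A3 (p w x y z : X) : ℝ :=
  if w = p ∧ x = p ∧ y = p ∧ z = p then 0
  else (dist x w * dist y z + dist x z * dist y w - dist x y * dist w z)
          / delta4 p w x y z ^ 2

open Classical in
/-- The quotient `|d(w,z) - d(x,y)/2| / δ_p(x,y)`, valued in `EReal`, with the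
conventions: `0` if `x = y = p` and `z = p`, and `+∞` if `x = y = p` but `z ≠ p`. -/
noncomputable def midQuot (p w x y z : X) : EReal :=
  if x = p ∧ y = p then (if z = p then (0 : EReal) else ⊤)
  else ((|dist w z - dist x y / 2| / max (dist x p) (dist y p) : ℝ) : EReal)

/-- `z` is an infinitesimal midpoint of the sequences `x` and `y`. -/
def IsInfinitesimalMidpoint (p : X) (x y z : ℕ → X) : Prop :=
  Tendsto (fun n => midQuot p (x n) (x n) (y n) (z n)) atTop (𝓝 (0 : EReal)) ∧
    Tendsto (fun n => midQuot p (y n) (x n) (y n) (z n)) atTop (𝓝 (0 : EReal))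

/-- `X` is midpoint convex at the marked point `p`. -/
def MidpointConvexAt (p : X) : Prop :=
  ∀ x y : ℕ → X, Tendsto x atTop (𝓝 p) → Tendsto y atTop (𝓝 p) →
    ∃ z : ℕ → X, IsInfinitesimalMidpoint p x y z

/-- `X` is Busemann convex at the marked point `p`. -/
def BusemannConvexAt (p : X) : Prop :=
  MidpointConvexAt p ∧
    ∀ x0 x1 y m : ℕ → X, Tendsto x0 atTop (𝓝 p) → Tendsto x1 atTop (𝓝 p) →
      Tendsto y atTop (𝓝 p) → IsInfinitesimalMidpoint p x0 x1 m →
      Tendsto (fun n =>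
          max (dist (m n) (y n) - (dist (x0 n) (y n) + dist (x1 n) (y n)) / 2) 0
            / delta3 p (x0 n) (y n) (x1 n)) atTop (𝓝 (0 : ℝ))

end Defs

section MetricDefs

/-- `s` is a geodesic segment with endpoints `x` and `y`: a subset isometric to
the closed interval `[0, d(x,y)]`, the endpoints of the interval corresponding
to `x` and `y`. -/
def IsGeodesicSegment {Z : Type u} [MetricSpace Z] (s : Set Z) (x y : Z) : Prop :=
  ∃ f : ℝ → Z,
    (∀ a ∈ Set.Icc 0 (dist x y), ∀ b ∈ Set.Icc 0 (dist x y),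
      dist (f a) (f b) = |a - b|) ∧
    f '' Set.Icc 0 (dist x y) = s ∧ f 0 = x ∧ f (dist x y) = y

/-- A metric space is geodesic if any two points are the endpoints of some
geodesic segment. -/
def IsGeodesicSpace (Y : Type u) [MetricSpace Y] : Prop :=
  ∀ x y : Y, ∃ s : Set Y, IsGeodesicSegment s x y

/-- `m` is a midpoint of `x` and `y`. -/
def IsMidpointOf {Z : Type u} [MetricSpace Z] (m x y : Z) : Prop :=
  dist m x = dist x y / 2 ∧ dist m y = dist x y / 2

/-- An affinely parametrized geodesic `γ : [a,b] → Z`: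
`d(γ s, γ t) = λ |s - t|` for some constant `λ ≥ 0`. -/
def IsAffineGeodesic {Z : Type u} [MetricSpace Z] (γ : ℝ → Z) (a b : ℝ) : Prop :=
  ∃ lam : ℝ, 0 ≤ lam ∧ ∀ s ∈ Set.Icc a b, ∀ t ∈ Set.Icc a b,
    dist (γ s) (γ t) = lam * |s - t|

/-- Busemann convexity of a (geodesic) metric space: for any two affinely
parametrized geodesics the joint distance function is convex. -/
def BusemannConvex (Y : Type u) [MetricSpace Y] : Prop :=
  ∀ (a b a' b' : ℝ) (γ γ' : ℝ → Y), IsAffineGeodesic γ a b →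
    IsAffineGeodesic γ' a' b' →
    ConvexOn ℝ (Set.Icc a b ×ˢ Set.Icc a' b')
      (fun q : ℝ × ℝ => dist (γ q.1) (γ' q.2))

/-- A metric space is Ptolemaic if the Ptolemy inequality holds. -/
def Ptolemaic (Y : Type u) [MetricSpace Y] : Prop :=
  ∀ x y u v : Y, dist x y * dist u v ≤ dist x u * dist y v + dist x v * dist y u

end MetricDefs

section Helpers

variable {X : Type u} [MetricSpace X]

theorem aux_selfStable_exists_maximal (p : X) (r : ℕ → ℝ) (S : Set (ℕ → X))
    (hS : SelfStable r S) (hp : (fun _ => p) ∈ S) :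
    ∃ F, S ⊆ F ∧ MaximalSelfStable p r F := by
  obtain ⟨F, hSF, hF⟩ := zorn_subset_nonempty {G : Set (ℕ → X) | SelfStable r G} (by
    intro c hc hchain _
    refine ⟨⋃₀ c, ?_, fun s hs => Set.subset_sUnion_of_mem hs⟩
    rintro x ⟨s, hs, hxs⟩ y ⟨t, ht, hyt⟩
    rcases hchain.total hs ht with h | h
    · exact hc ht x (h hxs) y hyt
    · exact hc hs x hxs y (h hyt)) S hS
  refine ⟨F, hSF, hF.prop, hSF hp, fun G hG hFG => ?_⟩
  exact (hF.eq_of_subset hG hFG).symm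

theorem aux_quotient (T : Type u) (P : PseudoMetricSpace T) :
    ∃ (Ω : Type u) (_ : MetricSpace Ω) (f : T → Ω), Function.Surjective f ∧
      ∀ x y, dist (f x) (f y) = P.dist x y :=
  ⟨SeparationQuotient T, inferInstance, SeparationQuotient.mk,
    SeparationQuotient.surjective_mk, fun x y => SeparationQuotient.dist_mk x y⟩

theorem aux_exists_pretangent (p : X) (r : ℕ → ℝ) (F : Set (ℕ → X))
    (hr : IsNormalizingSeq r) (hF : MaximalSelfStable p r F) :
    ∃ (Ω : Type u) (_ : MetricSpace Ω) (π : (ℕ → X) → Ω), IsPretangentSpace p r F π := by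
  classical
  have hst := hF.1
  choose! L hL using hst
  let P : PseudoMetricSpace F :=
    { dist := fun x y => L x.1 y.1
      dist_self := fun x => by
        refine tendsto_nhds_unique (hL x.1 x.2 x.1 x.2) ?_
        simp
      dist_comm := fun x y => by
        refine tendsto_nhds_unique (hL x.1 x.2 y.1 y.2) ?_
        simpa only [dist_comm] using hL y.1 y.2 x.1 x.2
      dist_triangle := fun x y z => by
        refine le_of_tendsto_of_tendsto' (hL x.1 x.2 z.1 z.2)
          ((hL x.1 x.2 y.1 y.2).add (hL y.1 y.2 z.1 z.2)) (fun n => ?_)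
        rw [← add_div]
        exact div_le_div_of_nonneg_right (dist_triangle _ _ _) (hr.1 n).le }
  obtain ⟨Ω, mΩ, f, hf, hd⟩ := aux_quotient F P
  refine ⟨Ω, mΩ, fun x => if h : x ∈ F then f ⟨x, h⟩ else f ⟨_, hF.2.1⟩, hr, hF, ?_, ?_⟩
  · intro ω
    obtain ⟨x, rfl⟩ := hf ω
    exact ⟨x.1, x.2, by simp⟩
  · intro x hx y hy
    simp only [hx, hy, dif_pos, hd]
    exact hL x hx y hy

theorem aux_delta_bound (p w x y z : X) :
    dist w p ≤ delta4 p w x y z ∧ dist x p ≤ delta4 p w x y z ∧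
    dist y p ≤ delta4 p w x y z ∧ dist z p ≤ delta4 p w x y z := by
  unfold delta4
  simp

theorem aux_delta_nonneg (p w x y z : X) : 0 ≤ delta4 p w x y z :=
  dist_nonneg.trans (aux_delta_bound p w x y z).1

theorem aux_A1_mul (p w x y z : X) :
    A1 p w x y z * delta4 p w x y z ^ 2 = dist w x ^ 2 + dist x y ^ 2 + dist y z ^ 2
      + dist z w ^ 2 - dist w y ^ 2 - dist x z ^ 2 := by
  unfold A1
  split_ifs with h
  · obtain ⟨rfl, rfl, rfl, rfl⟩ := h
    simp
  · have : delta4 p w x y z ≠ 0 := by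
      intro h0
      apply h
      obtain ⟨h1, h2, h3, h4⟩ := aux_delta_bound p w x y z
      rw [h0] at h1 h2 h3 h4
      exact ⟨dist_le_zero.1 h1, dist_le_zero.1 h2, dist_le_zero.1 h3, dist_le_zero.1 h4⟩
    field_simp

theorem aux_A1_bound (p w x y z : X) : |A1 p w x y z| ≤ 16 := by
  obtain ⟨h1, h2, h3, h4⟩ := aux_delta_bound p w x y z
  have h0 := aux_delta_nonneg p w x y z
  have hm := aux_A1_mul p w x y z
  have key : ∀ a b : X, dist a p ≤ delta4 p w x y z → dist b p ≤ delta4 p w x y z →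
      dist a b ^ 2 ≤ 4 * delta4 p w x y z ^ 2 := by
    intro a b ha hb
    have := dist_triangle_right a b p
    have h5 := dist_nonneg (x := a) (y := b)
    nlinarith
  have k1 := key w x h1 h2
  have k2 := key x y h2 h3
  have k3 := key y z h3 h4
  have k4 := key z w h4 h1
  have k5 := key w y h1 h3
  have k6 := key x z h2 h4
  rcases h0.eq_or_lt with h | h
  · have : A1 p w x y z = 0 := by
      unfold A1
      rw [← h]
      simp
    rw [this]; norm_num
  · have hd : 0 < delta4 p w x y z ^ 2 := by positivity
    rw [abs_le]
    constructor
    · by_contra! hc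
      nlinarith [sq_nonneg (dist w x), sq_nonneg (dist x y), sq_nonneg (dist y z),
        sq_nonneg (dist z w), mul_lt_mul_of_pos_right hc hd]
    · by_contra! hc
      nlinarith [sq_nonneg (dist w y), sq_nonneg (dist x z), mul_lt_mul_of_pos_right hc hd]

theorem aux_tendsto_p (p : X) {r : ℕ → ℝ} (hr : IsNormalizingSeq r) {x : ℕ → X} {L : ℝ}
    (h : Tendsto (fun n => dist (x n) p / r n) atTop (𝓝 L)) : Tendsto x atTop (𝓝 p) := by
  rw [tendsto_iff_dist_tendsto_zero]
  have := h.mul hr.2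
  rw [mul_zero] at this
  refine this.congr (fun n => ?_)
  have := (hr.1 n).ne'
  field_simp

theorem aux_num_div (p w x y z : X) (r : ℝ) :
    A1 p w x y z * (delta4 p w x y z / r) ^ 2 =
      (dist w x / r) ^ 2 + (dist x y / r) ^ 2 + (dist y z / r) ^ 2
      + (dist z w / r) ^ 2 - (dist w y / r) ^ 2 - (dist x z / r) ^ 2 := by
  have := aux_A1_mul p w x y z
  simp only [div_pow, ← mul_div_assoc]
  rw [this]; ring

end Helpers

theorem pretangent_quadrilateral_iff_liminf_A1_nonneg
    {X : Type u} [MetricSpace X] (p : X) :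
    (∀ (r : ℕ → ℝ) (F : Set (ℕ → X)) (Ω : Type u) [MetricSpace Ω]
        (π : (ℕ → X) → Ω), IsPretangentSpace p r F π →
        ∀ α β γ η : Ω, dist α β ^ 2 + dist γ η ^ 2 ≤
          dist α γ ^ 2 + dist α η ^ 2 + dist β γ ^ 2 + dist β η ^ 2) ↔
      0 ≤ liminf (fun q : X × X × X × X => A1 p q.1 q.2.1 q.2.2.1 q.2.2.2)
          (𝓝 (p, p, p, p)) := by
  have hbb : IsBoundedUnder (· ≥ ·) (𝓝 (p, p, p, p))
      (fun q : X × X × X × X => A1 p q.1 q.2.1 q.2.2.1 q.2.2.2) :=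
    isBoundedUnder_of ⟨-16, fun q => (abs_le.1 (aux_A1_bound p _ _ _ _)).1⟩
  have hba : IsBoundedUnder (· ≤ ·) (𝓝 (p, p, p, p))
      (fun q : X × X × X × X => A1 p q.1 q.2.1 q.2.2.1 q.2.2.2) :=
    isBoundedUnder_of ⟨16, fun q => (abs_le.1 (aux_A1_bound p _ _ _ _)).2⟩
  constructor
  · intro H
    by_contra! hlt
    obtain ⟨b, hb1, hb0⟩ := exists_between hlt
    have hfr := frequently_lt_of_liminf_lt hba.isCoboundedUnder_ge hb1
    obtain ⟨q, hq, hqA⟩ := exists_seq_forall_of_frequently hfr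
    let P : Fin 5 → ℕ → X := ![fun _ => p, fun n => (q n).1, fun n => (q n).2.1,
      fun n => (q n).2.2.1, fun n => (q n).2.2.2]
    let δ : ℕ → ℝ := fun n => delta4 p (q n).1 (q n).2.1 (q n).2.2.1 (q n).2.2.2
    have hδpos : ∀ n, 0 < δ n := by
      intro n
      rcases (aux_delta_nonneg p (q n).1 (q n).2.1 (q n).2.2.1 (q n).2.2.2).eq_or_lt with h | h
      · exfalso
        have h1 := hqA n
        have : A1 p (q n).1 (q n).2.1 (q n).2.2.1 (q n).2.2.2 = 0 := by
          unfold A1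
          rw [← h]
          simp
        linarith
      · exact h
    have hδ0 : Tendsto δ atTop (𝓝 0) := by
      have hc : Continuous (fun q : X × X × X × X => delta4 p q.1 q.2.1 q.2.2.1 q.2.2.2) := by
        unfold delta4
        fun_prop
      have := (hc.tendsto (p, p, p, p)).comp hq
      have h0 : delta4 p p p p p = 0 := by simp [delta4]
      simp only [h0] at this
      exact this
    have hPδ : ∀ i n, dist (P i n) p ≤ δ n := by
      intro i n
      obtain ⟨h1, h2, h3, h4⟩ := aux_delta_bound p (q n).1 (q n).2.1 (q n).2.2.1 (q n).2.2.2
      fin_cases i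
      · simpa [P] using (hδpos n).le
      · exact h1
      · exact h2
      · exact h3
      · exact h4
    let v : ℕ → (Fin 5 × Fin 5 → ℝ) := fun n ij => dist (P ij.1 n) (P ij.2 n) / δ n
    have hv : ∀ n, v n ∈ Set.pi Set.univ (fun _ : Fin 5 × Fin 5 => Set.Icc (0 : ℝ) 2) := by
      intro n ij _
      refine ⟨div_nonneg dist_nonneg (hδpos n).le, ?_⟩
      rw [div_le_iff₀ (hδpos n)]
      have := dist_triangle_right (P ij.1 n) (P ij.2 n) p
      linarith [hPδ ij.1 n, hPδ ij.2 n]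
    obtain ⟨ℓ, -, φ, hφ, hlim⟩ :=
      (isCompact_univ_pi (fun _ : Fin 5 × Fin 5 => isCompact_Icc)).tendsto_subseq hv
    rw [tendsto_pi_nhds] at hlim
    have hlim' : ∀ i j, Tendsto (fun n => dist (P i (φ n)) (P j (φ n)) / δ (φ n)) atTop
        (𝓝 (ℓ (i, j))) := fun i j => hlim (i, j)
    let r : ℕ → ℝ := fun n => δ (φ n)
    have hr : IsNormalizingSeq r := ⟨fun n => hδpos _, hδ0.comp hφ.tendsto_atTop⟩
    let Q : Fin 5 → ℕ → X := fun i n => P i (φ n)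
    obtain ⟨F, hSF, hF⟩ := aux_selfStable_exists_maximal p r (Set.range Q)
      (by rintro _ ⟨i, rfl⟩ _ ⟨j, rfl⟩; exact ⟨_, hlim' i j⟩) ⟨0, rfl⟩
    obtain ⟨Ω, _, π, hπ⟩ := aux_exists_pretangent p r F hr hF
    have hd : ∀ i j, Tendsto (fun n => dist (P i (φ n)) (P j (φ n)) / δ (φ n)) atTop
        (𝓝 (dist (π (Q i)) (π (Q j)))) :=
      fun i j => hπ.2.2.2 (Q i) (hSF ⟨i, rfl⟩) (Q j) (hSF ⟨j, rfl⟩)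
    have hineq := H r F Ω π hπ (π (Q 1)) (π (Q 3)) (π (Q 2)) (π (Q 4))
    have hT := ((((((hd 1 2).pow 2).add ((hd 2 3).pow 2)).add ((hd 3 4).pow 2)).add
      ((hd 4 1).pow 2)).sub ((hd 1 3).pow 2)).sub ((hd 2 4).pow 2)
    have hle := le_of_tendsto' hT (b := b) (by
      intro n
      have h1 := hqA (φ n)
      have h2 := aux_num_div p (P 1 (φ n)) (P 2 (φ n)) (P 3 (φ n)) (P 4 (φ n)) (δ (φ n))
      have h3 : delta4 p (P 1 (φ n)) (P 2 (φ n)) (P 3 (φ n)) (P 4 (φ n)) / δ (φ n) = 1 :=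
        div_self (hδpos (φ n)).ne'
      rw [h3, one_pow, mul_one] at h2
      rw [← h2]
      exact h1.le)
    rw [dist_comm (π (Q 4)) (π (Q 1)), dist_comm (π (Q 2)) (π (Q 3))] at hle
    linarith
  · intro H r F Ω _ π hπ α β γ η
    obtain ⟨hr, hF, hsurj, hdist⟩ := hπ
    obtain ⟨a, ha, rfl⟩ := hsurj α
    obtain ⟨b, hb, rfl⟩ := hsurj β
    obtain ⟨c, hc, rfl⟩ := hsurj γ
    obtain ⟨e, he, rfl⟩ := hsurj η
    have hpa := hdist a ha _ hF.2.1
    have hpb := hdist b hb _ hF.2.1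
    have hpc := hdist c hc _ hF.2.1
    have hpe := hdist e he _ hF.2.1
    have htend : Tendsto (fun n => (a n, c n, b n, e n)) atTop (𝓝 (p, p, p, p)) :=
      (aux_tendsto_p p hr hpa).prodMk_nhds ((aux_tendsto_p p hr hpc).prodMk_nhds
        ((aux_tendsto_p p hr hpb).prodMk_nhds (aux_tendsto_p p hr hpe)))
    have hT := (((((((hdist a ha c hc).pow 2).add ((hdist c hc b hb).pow 2)).add
      ((hdist b hb e he).pow 2)).add ((hdist e he a ha).pow 2)).sub
      ((hdist a ha b hb).pow 2)).sub ((hdist c hc e he).pow 2))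
    have hD := (hpa.max (hpc.max (hpb.max hpe))).pow 2
    set D := max (dist (π a) (π fun _ => p)) (max (dist (π c) (π fun _ => p))
      (max (dist (π b) (π fun _ => p)) (dist (π e) (π fun _ => p)))) with hDdef
    have key : ∀ ε : ℝ, 0 < ε → -ε * D ^ 2 ≤ dist (π a) (π c) ^ 2 + dist (π c) (π b) ^ 2
        + dist (π b) (π e) ^ 2 + dist (π e) (π a) ^ 2 - dist (π a) (π b) ^ 2
        - dist (π c) (π e) ^ 2 := by
      intro ε hε
      have hev := eventually_lt_of_lt_liminf (lt_of_lt_of_le (neg_lt_zero.2 hε) H) hbb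
      refine le_of_tendsto_of_tendsto (hD.const_mul (-ε)) hT ?_
      filter_upwards [htend.eventually hev] with n hn
      have h2 := aux_num_div p (a n) (c n) (b n) (e n) (r n)
      rw [← h2]
      have h3 : delta4 p (a n) (c n) (b n) (e n) / r n = max (dist (a n) p / r n)
          (max (dist (c n) p / r n) (max (dist (b n) p / r n) (dist (e n) p / r n))) := by
        unfold delta4
        simp only [max_div_div_right (hr.1 n).le]
      rw [h3]
      exact mul_le_mul_of_nonneg_right hn.le (sq_nonneg _)
    have h0 : 0 ≤ dist (π a) (π c) ^ 2 + dist (π c) (π b) ^ 2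
        + dist (π b) (π e) ^ 2 + dist (π e) (π a) ^ 2 - dist (π a) (π b) ^ 2
        - dist (π c) (π e) ^ 2 := by
      refine le_of_forall_pos_lt_add fun ε hε => ?_
      have hD1 : 0 < D ^ 2 + 1 := by positivity
      have := key (ε / (D ^ 2 + 1)) (by positivity)
      have h5 : ε / (D ^ 2 + 1) * D ^ 2 < ε := by
        rw [div_mul_eq_mul_div, div_lt_iff₀ hD1]
        nlinarith
      linarith
    rw [dist_comm (π c) (π b), dist_comm (π e) (π a)] at h0
    linarith
end

section
/- Let (X,d) be a metric space with marked point p. If X is midpoint convex at p and liminf_{w,x,y,z→p} A₂(w,x,y,z) ≥ 0, then every separable tangent space Ω_{p,r̃}^X is a complete geodesic metric space whose metric ρ satisfies (1/3)(ρ²(α,β)+ρ²(β,γ)+ρ²(γ,α)) ≤ ρ²(η,α)+ρ²(η,β)+ρ²(η,γ) for all α,β,γ,η (i.e., Ω_{p,r̃}^X is a space of nonnegative Aleksandrov curvature by the Lebedeva–Petrunin characterization). -/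
open Filter Topology

universe u

section Helpers

/-- A complete metric space with midpoints is geodesic. -/
theorem geodesic_of_midpoints {Z : Type u} [MetricSpace Z] [CompleteSpace Z]
    (hm : ∀ x y : Z, ∃ m : Z, dist x m = dist x y / 2 ∧ dist y m = dist x y / 2) :
    IsGeodesicSpace Z := by
  intro x y
  set L := dist x y with hL
  have hL0 : 0 ≤ L := dist_nonneg
  let P : Set (Set (ℝ × Z)) := {G | (∀ u ∈ G, u.1 ∈ Set.Icc 0 L) ∧
    ∀ u ∈ G, ∀ v ∈ G, dist u.2 v.2 = |u.1 - v.1|}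
  let G0 : Set (ℝ × Z) := {((0 : ℝ), x), (L, y)}
  have hG0 : G0 ∈ P := by
    constructor
    · rintro u (rfl | rfl) <;> simp [hL0]
    · rintro u (rfl | rfl) v (rfl | rfl) <;>
        simp [abs_of_nonneg hL0, dist_comm, hL]
  obtain ⟨G, hG0G, hGmax⟩ := zorn_subset_nonempty P (by
    intro c hc hchain hne
    refine ⟨⋃₀ c, ⟨?_, ?_⟩, fun s hs => Set.subset_sUnion_of_mem hs⟩
    · rintro u ⟨s, hs, hu⟩
      exact (hc hs).1 u hu
    · rintro u ⟨s, hs, hu⟩ v ⟨t, ht, hv⟩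
      rcases hchain.total hs ht with h | h
      · exact (hc ht).2 u (h hu) v hv
      · exact (hc hs).2 u hu v (h hv)) G0 hG0
  have hGP : G ∈ P := hGmax.1
  have hext : ∀ G' ∈ P, G ⊆ G' → G' ⊆ G := fun G' h1 h2 => hGmax.2 h1 h2
  have hcl : IsClosed G := by
    apply isClosed_of_closure_subset
    apply hext _ _ subset_closure
    constructor
    · have : IsClosed {u : ℝ × Z | u.1 ∈ Set.Icc 0 L} := isClosed_Icc.preimage continuous_fst
      exact fun u hu => closure_minimal hGP.1 this hu
    · intro u hu v hv
      have h := closure_minimal (s := G ×ˢ G)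
        (t := {w : (ℝ × Z) × (ℝ × Z) | dist w.1.2 w.2.2 = |w.1.1 - w.2.1|})
        (fun w hw => hGP.2 _ hw.1 _ hw.2) (isClosed_eq (by fun_prop) (by fun_prop))
      have h2 : (u, v) ∈ closure (G ×ˢ G) := by
        rw [closure_prod_eq]; exact ⟨hu, hv⟩
      exact h h2
  have hS : IsClosed (Prod.fst '' G) := by
    have : CompleteSpace G := hcl.completeSpace_coe
    have hi : Isometry (fun u : G => u.1.1) := by
      refine Isometry.of_dist_eq fun u v => ?_
      rw [Subtype.dist_eq, Prod.dist_eq, hGP.2 _ u.2 _ v.2, Real.dist_eq, max_self]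
    have h := hi.isClosedEmbedding.isClosed_range
    convert h using 1
    ext t; simp
  have h0 : ((0 : ℝ), x) ∈ G := hG0G (by simp [G0])
  have h1 : (L, y) ∈ G := hG0G (by simp [G0])
  have hall : ∀ t ∈ Set.Icc 0 L, ∃ z, (t, z) ∈ G := by
    intro t ht
    by_contra hcon
    have htS : t ∉ Prod.fst '' G := by
      rintro ⟨⟨t', z⟩, h, rfl⟩; exact hcon ⟨z, h⟩
    have ha : sSup (Prod.fst '' G ∩ Set.Iic t) ∈ Prod.fst '' G ∩ Set.Iic t :=
      (hS.inter isClosed_Iic).csSup_mem ⟨0, ⟨_, h0, rfl⟩, ht.1⟩ ⟨t, fun s hs => hs.2⟩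
    have hb : sInf (Prod.fst '' G ∩ Set.Ici t) ∈ Prod.fst '' G ∩ Set.Ici t :=
      (hS.inter isClosed_Ici).csInf_mem ⟨L, ⟨_, h1, rfl⟩, ht.2⟩ ⟨t, fun s hs => hs.2⟩
    have ha' : ∀ s ∈ Prod.fst '' G, s ≤ t → s ≤ sSup (Prod.fst '' G ∩ Set.Iic t) :=
      fun s hs hst => le_csSup ⟨t, fun s hs => hs.2⟩ ⟨hs, hst⟩
    have hb' : ∀ s ∈ Prod.fst '' G, t ≤ s → sInf (Prod.fst '' G ∩ Set.Ici t) ≤ s :=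
      fun s hs hst => csInf_le ⟨t, fun s hs => hs.2⟩ ⟨hs, hst⟩
    generalize sSup (Prod.fst '' G ∩ Set.Iic t) = a at ha ha'
    generalize sInf (Prod.fst '' G ∩ Set.Ici t) = b at hb hb'
    obtain ⟨⟨⟨a, za⟩, hza, rfl⟩, hat⟩ := ha
    obtain ⟨⟨⟨b, zb⟩, hzb, rfl⟩, htb⟩ := hb
    simp only [Set.mem_Iic, Set.mem_Ici] at hat htb ha' hb'
    have hat' : a < t := lt_of_le_of_ne hat (fun h => hcon ⟨za, h ▸ hza⟩)
    have htb' : t < b := lt_of_le_of_ne htb (fun h => hcon ⟨zb, h ▸ hzb⟩)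
    obtain ⟨m, hm1, hm2⟩ := hm za zb
    have hab : dist za zb = b - a := by
      have := hGP.2 _ hza _ hzb
      simp only at this
      rw [this, abs_sub_comm, abs_of_nonneg (by linarith)]
    rw [hab] at hm1 hm2
    have haI := hGP.1 _ hza
    have hbI := hGP.1 _ hzb
    simp only [Set.mem_Icc] at haI hbI
    have key : ∀ u ∈ G, dist u.2 m = |u.1 - (a + b) / 2| := by
      intro u hu
      have hua := hGP.2 _ hu _ hza
      have hub := hGP.2 _ hu _ hzb
      simp only at hua hub
      have t1 := dist_triangle u.2 za m
      have t2 := dist_triangle u.2 m zb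
      have t3 := dist_triangle u.2 zb m
      have t4 := dist_triangle u.2 m za
      rw [dist_comm m] at t2 t4
      rcases le_total u.1 t with h | h
      · have := ha' _ ⟨u, hu, rfl⟩ h
        rw [abs_of_nonpos (by linarith)] at hua hub
        rw [abs_of_nonpos (by linarith)]
        linarith
      · have := hb' _ ⟨u, hu, rfl⟩ h
        rw [abs_of_nonneg (by linarith)] at hua hub
        rw [abs_of_nonneg (by linarith)]
        linarith
    have hnew : insert ((a + b) / 2, m) G ∈ P := by
      constructor
      · rintro u (rfl | hu)
        · simp only [Set.mem_Icc]; constructor <;> linarith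
        · exact hGP.1 u hu
      · rintro u (rfl | hu) v (rfl | hv)
        · simp
        · rw [dist_comm, key v hv, abs_sub_comm]
        · exact key u hu
        · exact hGP.2 u hu v hv
    have hin := hext _ hnew (Set.subset_insert _ _) (Set.mem_insert _ _)
    rcases le_total ((a + b) / 2) t with h | h
    · have := ha' _ ⟨_, hin, rfl⟩ h
      simp only at this; linarith
    · have := hb' _ ⟨_, hin, rfl⟩ h
      simp only at this; linarith
  have huniq : ∀ t z z', (t, z) ∈ G → (t, z') ∈ G → z = z' := by
    intro t z z' h h'
    have := hGP.2 _ h _ h'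
    simpa using this
  have : Nonempty Z := ⟨x⟩
  choose! f hf using hall
  refine ⟨f '' Set.Icc 0 L, f, ?_, rfl, ?_, ?_⟩
  · intro a ha b hb
    exact hGP.2 _ (hf a ha) _ (hf b hb)
  · exact huniq _ _ _ (hf 0 ⟨le_rfl, hL0⟩) h0
  · exact huniq _ _ _ (hf L ⟨hL0, le_rfl⟩) h1

variable {X : Type u} [MetricSpace X]

/-- A sequence stable with every member of a maximal family belongs to it. -/
theorem mem_of_stable {p : X} {r : ℕ → ℝ} {F : Set (ℕ → X)} (hF : MaximalSelfStable p r F)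
    {y : ℕ → X} (hy : ∀ x ∈ F, MutuallyStable r y x) : y ∈ F := by
  have hself : MutuallyStable r y y := ⟨0, by simp⟩
  have hsymm : ∀ x ∈ F, MutuallyStable r x y := by
    intro x hx
    obtain ⟨L, hL⟩ := hy x hx
    exact ⟨L, by simpa only [dist_comm] using hL⟩
  have : insert y F = F := by
    apply hF.2.2 _ _ (Set.subset_insert _ _)
    rintro u (rfl | hu) v (rfl | hv)
    · exact hself
    · exact hy v hv
    · exact hsymm u hu
    · exact hF.1 u hu v hv
  rw [← this]; exact Set.mem_insert _ _

/-- Zorn extension of a self-stable family. -/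
theorem exists_maximal {p : X} {r : ℕ → ℝ} {F : Set (ℕ → X)} (hF : SelfStable r F)
    (hp : (fun _ => p) ∈ F) : ∃ F', MaximalSelfStable p r F' ∧ F ⊆ F' := by
  obtain ⟨G, hFG, hmax⟩ := zorn_subset_nonempty {G : Set (ℕ → X) | SelfStable r G} (by
    intro c hc hchain hne
    refine ⟨⋃₀ c, ?_, fun s hs => Set.subset_sUnion_of_mem hs⟩
    rintro u ⟨s, hs, hu⟩ v ⟨t, ht, hv⟩
    rcases hchain.total hs ht with h | h
    · exact hc ht u (h hu) v hv
    · exact hc hs u hu v (h hv)) F hF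
  exact ⟨G, ⟨hmax.1, hFG hp, fun G' h1 h2 => (hmax.2 h1 h2).antisymm h2⟩, hFG⟩

/-- Approximation by convergent quotients gives convergence. -/
theorem tendsto_of_approx (u : ℕ → ℝ)
    (h : ∀ ε > 0, ∃ v : ℕ → ℝ, (∃ L, Tendsto v atTop (𝓝 L)) ∧
      ∀ᶠ n in atTop, |u n - v n| ≤ ε) : ∃ L, Tendsto u atTop (𝓝 L) := by
  apply cauchySeq_tendsto_of_complete
  rw [Metric.cauchySeq_iff']
  intro ε hε
  obtain ⟨v, ⟨L, hL⟩, hv⟩ := h (ε / 5) (by positivity)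
  have hv2 := hv.and (Metric.tendsto_nhds.1 hL (ε / 5) (by positivity))
  obtain ⟨N, hN⟩ := eventually_atTop.1 hv2
  refine ⟨N, fun n hn => ?_⟩
  obtain ⟨a1, a2⟩ := hN n hn
  obtain ⟨b1, b2⟩ := hN N le_rfl
  rw [Real.dist_eq] at *
  rw [abs_lt] at *
  rw [abs_le] at *
  constructor <;> linarith

theorem midQuot_bound {p w x y z : X} (hw : w = x ∨ w = y) {r : ℝ} (hr : 0 < r)
    (h : midQuot p w x y z < ⊤) :
    |dist w z - dist x y / 2| / r =
      (midQuot p w x y z).toReal * (max (dist x p) (dist y p) / r) := by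
  unfold midQuot at *
  split_ifs at * with h1 h2
  · obtain ⟨rfl, rfl⟩ := h1
    subst h2
    rcases hw with rfl | rfl <;> simp
  · simp at h
  · rw [EReal.toReal_coe]
    have : 0 < max (dist x p) (dist y p) := by
      rw [lt_max_iff, dist_pos, dist_pos]
      tauto
    field_simp

theorem midQuot_tendsto {p : X} {r : ℕ → ℝ} (hr : ∀ n, 0 < r n) {w x y z : ℕ → X}
    (hw : w = x ∨ w = y) {A B D : ℝ}
    (hx : Tendsto (fun n => dist (x n) p / r n) atTop (𝓝 A))
    (hy : Tendsto (fun n => dist (y n) p / r n) atTop (𝓝 B))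
    (hxy : Tendsto (fun n => dist (x n) (y n) / r n) atTop (𝓝 D))
    (h : Tendsto (fun n => midQuot p (w n) (x n) (y n) (z n)) atTop (𝓝 (0 : EReal))) :
    Tendsto (fun n => dist (w n) (z n) / r n) atTop (𝓝 (D / 2)) := by
  have h1 : Tendsto (fun n => (midQuot p (w n) (x n) (y n) (z n)).toReal) atTop (𝓝 0) := by
    have := (EReal.tendsto_toReal (a := 0) (by simp) (by simp)).comp h
    rw [EReal.toReal_zero] at this
    exact this
  have h2 := h1.mul (hx.max hy)
  rw [zero_mul] at h2
  have h3 : Tendsto (fun n => |dist (w n) (z n) - dist (x n) (y n) / 2| / r n) atTop (𝓝 0) := by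
    refine h2.congr' ?_
    filter_upwards [h.eventually_lt_const (show (0 : EReal) < ⊤ by simp)] with n hn
    rw [midQuot_bound (by rcases hw with rfl | rfl <;> simp) (hr n) hn,
      max_div_div_right (hr n).le]
  have h4 : Tendsto (fun n => (dist (w n) (z n) - dist (x n) (y n) / 2) / r n) atTop (𝓝 0) := by
    rw [tendsto_zero_iff_abs_tendsto_zero]
    refine h3.congr fun n => ?_
    simp [abs_div, abs_of_pos (hr n)]
  have h5 := h4.add (hxy.div_const 2)
  rw [zero_add] at h5
  refine h5.congr fun n => ?_
  ring

theorem tendsto_p {p : X} {r : ℕ → ℝ} (hr : IsNormalizingSeq r) {x : ℕ → X} {A : ℝ}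
    (hx : Tendsto (fun n => dist (x n) p / r n) atTop (𝓝 A)) : Tendsto x atTop (𝓝 p) := by
  rw [tendsto_iff_dist_tendsto_zero]
  have := hx.mul hr.2
  rw [mul_zero] at this
  refine this.congr fun n => ?_
  have := hr.1 n
  field_simp

theorem A2_bounds (p w x y z : X) : -4 ≤ A2 p w x y z ∧ A2 p w x y z ≤ 12 := by
  unfold A2
  split_ifs with h
  · norm_num
  · have hd : 0 < delta4 p w x y z := by
      unfold delta4
      simp only [lt_max_iff, dist_pos]
      tauto
    have hw : dist w p ≤ delta4 p w x y z := by simp [delta4]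
    have hx : dist x p ≤ delta4 p w x y z := by simp [delta4]
    have hy : dist y p ≤ delta4 p w x y z := by simp [delta4]
    have hz : dist z p ≤ delta4 p w x y z := by simp [delta4]
    generalize delta4 p w x y z = d at *
    have key : ∀ a b : X, dist a p ≤ d → dist b p ≤ d → dist a b ^ 2 ≤ 4 * d ^ 2 := by
      intro a b ha hb
      have := dist_triangle_right a b p
      have h0 : 0 ≤ dist a b := dist_nonneg
      nlinarith
    have k1 := key w x hw hx
    have k2 := key w y hw hy
    have k3 := key w z hw hz
    have k4 := key x y hx hy
    have k5 := key y z hy hz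
    have k6 := key z x hz hx
    have hd2 : 0 < d ^ 2 := by positivity
    rw [le_div_iff₀ hd2, div_le_iff₀ hd2]
    constructor
    · nlinarith [sq_nonneg (dist w x), sq_nonneg (dist w y), sq_nonneg (dist w z)]
    · nlinarith [sq_nonneg (dist x y), sq_nonneg (dist y z), sq_nonneg (dist z x)]

theorem LP_ineq {p : X}
    (hA2 : 0 ≤ liminf (fun q : X × X × X × X => A2 p q.1 q.2.1 q.2.2.1 q.2.2.2)
        (𝓝 (p, p, p, p)))
    {r : ℕ → ℝ} (hr : IsNormalizingSeq r) {w x y z : ℕ → X} {a b c d wx wy wz xy yz zx : ℝ}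
    (ha : Tendsto (fun n => dist (w n) p / r n) atTop (𝓝 a))
    (hb : Tendsto (fun n => dist (x n) p / r n) atTop (𝓝 b))
    (hc : Tendsto (fun n => dist (y n) p / r n) atTop (𝓝 c))
    (hd : Tendsto (fun n => dist (z n) p / r n) atTop (𝓝 d))
    (h1 : Tendsto (fun n => dist (w n) (x n) / r n) atTop (𝓝 wx))
    (h2 : Tendsto (fun n => dist (w n) (y n) / r n) atTop (𝓝 wy))
    (h3 : Tendsto (fun n => dist (w n) (z n) / r n) atTop (𝓝 wz))
    (h4 : Tendsto (fun n => dist (x n) (y n) / r n) atTop (𝓝 xy))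
    (h5 : Tendsto (fun n => dist (y n) (z n) / r n) atTop (𝓝 yz))
    (h6 : Tendsto (fun n => dist (z n) (x n) / r n) atTop (𝓝 zx)) :
    (xy ^ 2 + yz ^ 2 + zx ^ 2) / 3 ≤ wx ^ 2 + wy ^ 2 + wz ^ 2 := by
  have hlim : Tendsto (fun n => (w n, x n, y n, z n)) atTop (𝓝 (p, p, p, p)) :=
    (tendsto_p hr ha).prodMk_nhds ((tendsto_p hr hb).prodMk_nhds
      ((tendsto_p hr hc).prodMk_nhds (tendsto_p hr hd)))
  have hbdd : IsBoundedUnder (· ≥ ·) (𝓝 (p, p, p, p))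
      (fun q : X × X × X × X => A2 p q.1 q.2.1 q.2.2.1 q.2.2.2) :=
    ⟨-4, by simpa using Eventually.of_forall fun q => (A2_bounds p _ _ _ _).1⟩
  have hD := ha.max (hb.max (hc.max hd))
  have hN := ((h1.pow 2).add (h2.pow 2)).add (h3.pow 2) |>.sub
    ((((h4.pow 2).add (h5.pow 2)).add (h6.pow 2)).div_const 3)
  have hε : ∀ ε > 0, -ε * (max a (max b (max c d))) ^ 2 ≤
      wx ^ 2 + wy ^ 2 + wz ^ 2 - (xy ^ 2 + yz ^ 2 + zx ^ 2) / 3 := by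
    intro ε hε
    have hev := hlim.eventually (eventually_lt_of_lt_liminf
      (lt_of_lt_of_le (neg_lt_zero.2 hε) hA2) hbdd)
    refine le_of_tendsto_of_tendsto ((hD.pow 2).const_mul (-ε)) hN ?_
    filter_upwards [hev] with n hn
    have hrn := hr.1 n
    have hmax : max (dist (w n) p / r n) (max (dist (x n) p / r n)
        (max (dist (y n) p / r n) (dist (z n) p / r n))) =
        delta4 p (w n) (x n) (y n) (z n) / r n := by
      unfold delta4
      simp only [max_div_div_right hrn.le]
    rw [hmax]
    simp only [A2] at hn
    have hmain : -ε * delta4 p (w n) (x n) (y n) (z n) ^ 2 ≤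
        dist (w n) (x n) ^ 2 + dist (w n) (y n) ^ 2 + dist (w n) (z n) ^ 2 -
        (dist (x n) (y n) ^ 2 + dist (y n) (z n) ^ 2 + dist (z n) (x n) ^ 2) / 3 := by
      split_ifs at hn with h
      · obtain ⟨e1, e2, e3, e4⟩ := h
        simp [e1, e2, e3, e4, delta4]
      · have hd : 0 < delta4 p (w n) (x n) (y n) (z n) := by
          unfold delta4
          simp only [lt_max_iff, dist_pos]
          tauto
        rw [lt_div_iff₀ (by positivity)] at hn
        exact hn.le
    have h := div_le_div_of_nonneg_right hmain (sq_nonneg (r n))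
    calc _ = _ := by ring
      _ ≤ _ := h
      _ = _ := by ring
  have hlim0 : Tendsto (fun ε : ℝ => -ε * (max a (max b (max c d))) ^ 2) (𝓝[>] 0) (𝓝 0) := by
    have : Tendsto (fun ε : ℝ => -ε * (max a (max b (max c d))) ^ 2) (𝓝 0)
        (𝓝 (-0 * (max a (max b (max c d))) ^ 2)) := Continuous.tendsto (by fun_prop) 0
    rw [neg_zero, zero_mul] at this
    exact this.mono_left nhdsWithin_le_nhds
  have := le_of_tendsto hlim0 (eventually_mem_nhdsWithin.mono fun ε h => hε ε h)
  linarith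

theorem approx_dist {r : ℝ} (hr : 0 < r) (a b c : X) :
    |dist a c / r - dist b c / r| ≤ dist a b / r := by
  rw [← sub_div, abs_div, abs_of_pos hr]
  gcongr
  exact abs_dist_sub_le a b c

theorem complete_pretangent {p : X} {r : ℕ → ℝ} {F : Set (ℕ → X)} {Ω : Type u} [MetricSpace Ω]
    {π : (ℕ → X) → Ω} (hP : IsPretangentSpace p r F π) : CompleteSpace Ω := by
  obtain ⟨hr, hF, hsurj, hdist⟩ := hP
  apply Metric.complete_of_cauchySeq_tendsto
  intro α hα
  choose x hxF hx using fun k => hsurj (α k)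
  have hpair : ∀ i j, Tendsto (fun n => dist (x i n) (x j n) / r n) atTop
      (𝓝 (dist (α i) (α j))) := by
    intro i j
    have := hdist _ (hxF i) _ (hxF j)
    rwa [hx, hx] at this
  have hev : ∀ k : ℕ, ∃ N, ∀ n ≥ N, ∀ j ≤ k,
      dist (x k n) (x j n) / r n < dist (α k) (α j) + 1 / ((k : ℝ) + 1) := by
    intro k
    have : ∀ᶠ n in atTop, ∀ j ∈ Set.Iic k,
        dist (x k n) (x j n) / r n < dist (α k) (α j) + 1 / ((k : ℝ) + 1) := by
      rw [eventually_all_finite (Set.finite_Iic k)]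
      intro j _
      exact (hpair k j).eventually_lt_const (by have : 0 < 1 / ((k : ℝ) + 1) := by positivity
                                                linarith)
    exact eventually_atTop.1 this
  choose N hN using hev
  -- the slowly growing index
  have hk : ∃ k : ℕ → ℕ, Tendsto k atTop atTop ∧ ∀ᶠ n in atTop, N (k n) ≤ n := by
    classical
    let k : ℕ → ℕ := fun n => Nat.findGreatest (fun k => N k ≤ n) n
    refine ⟨k, ?_, ?_⟩
    · rw [tendsto_atTop]
      intro b
      filter_upwards [eventually_ge_atTop b, eventually_ge_atTop (N b)] with n h1 h2
      exact Nat.le_findGreatest h1 h2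
    · filter_upwards [eventually_ge_atTop (N 0)] with n hn
      exact Nat.findGreatest_spec (P := fun k => N k ≤ n) (Nat.zero_le n) hn
  obtain ⟨k, hk1, hk2⟩ := hk
  let y : ℕ → X := fun n => x (k n) n
  have hy : ∀ ε > 0, ∃ J, ∀ j ≥ J, ∀ᶠ n in atTop, dist (y n) (x j n) / r n ≤ ε := by
    intro ε hε
    obtain ⟨J, hJ⟩ := Metric.cauchySeq_iff.1 hα (ε / 2) (by positivity)
    refine ⟨J, fun j hj => ?_⟩
    have h1 : ∀ᶠ m : ℕ in atTop, 1 / ((m : ℝ) + 1) < ε / 2 :=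
      tendsto_one_div_add_atTop_nhds_zero_nat.eventually_lt_const (by positivity)
    filter_upwards [hk1.eventually_ge_atTop j, hk2, hk1.eventually h1] with n a1 a2 a3
    have b1 := hN (k n) n a2 j a1
    have b2 := hJ (k n) (hj.trans a1) j hj
    simp only [y]
    linarith
  have hyF : y ∈ F := by
    apply mem_of_stable hF
    intro z hz
    apply tendsto_of_approx
    intro ε hε
    obtain ⟨J, hJ⟩ := hy ε hε
    refine ⟨fun n => dist (x J n) (z n) / r n, hF.1 _ (hxF J) _ hz, ?_⟩
    filter_upwards [hJ J le_rfl] with n hn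
    exact (approx_dist (hr.1 n) _ _ _).trans hn
  refine ⟨π y, ?_⟩
  rw [Metric.tendsto_atTop]
  intro ε hε
  obtain ⟨J, hJ⟩ := hy (ε / 2) (by positivity)
  refine ⟨J, fun j hj => ?_⟩
  have h := le_of_tendsto (hdist _ hyF _ (hxF j)) (hJ j hj)
  rw [hx, dist_comm] at h
  linarith

theorem midpoint_tangent {p : X} (hmid : MidpointConvexAt p)
    {r : ℕ → ℝ} {F : Set (ℕ → X)} {Ω : Type u} [MetricSpace Ω]
    {π : (ℕ → X) → Ω} (hP : IsPretangentSpace p r F π) (hT : IsTangentFamily p r F)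
    (hsep : TopologicalSpace.SeparableSpace Ω) (α β : Ω) :
    ∃ m : Ω, dist α m = dist α β / 2 ∧ dist β m = dist α β / 2 := by
  obtain ⟨hr, hF, hsurj, hdist⟩ := hP
  obtain ⟨x, hxF, rfl⟩ := hsurj α
  obtain ⟨y, hyF, rfl⟩ := hsurj β
  have hxp := hdist x hxF _ hF.2.1
  have hyp := hdist y hyF _ hF.2.1
  have hxy := hdist x hxF y hyF
  obtain ⟨z, hz1, hz2⟩ := hmid x y (tendsto_p hr hxp) (tendsto_p hr hyp)
  have hxz := midQuot_tendsto hr.1 (Or.inl rfl) hxp hyp hxy hz1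
  have hyz := midQuot_tendsto hr.1 (Or.inr rfl) hxp hyp hxy hz2
  have : Nonempty Ω := ⟨π x⟩
  obtain ⟨e, he⟩ := TopologicalSpace.exists_dense_seq Ω
  choose s hsF hs using fun k => hsurj (e k)
  -- bounded quotients
  have hb : ∀ k, ∃ C, ∀ n, dist (z n) (s k n) / r n ≤ C := by
    intro k
    obtain ⟨C1, hC1⟩ := hxz.bddAbove_range
    obtain ⟨C2, hC2⟩ := (hdist x hxF _ (hsF k)).bddAbove_range
    refine ⟨C1 + C2, fun n => ?_⟩
    have a1 := hC1 ⟨n, rfl⟩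
    have a2 := hC2 ⟨n, rfl⟩
    have a3 : dist (z n) (s k n) / r n ≤ (dist (x n) (z n) + dist (x n) (s k n)) / r n := by
      have := hr.1 n
      gcongr
      exact dist_triangle_left _ _ _
    rw [add_div] at a3
    simp only at a1 a2
    linarith
  choose C hC using hb
  have hcomp : IsCompact (Set.pi Set.univ fun k : ℕ => Set.Icc (0 : ℝ) (C k)) :=
    isCompact_univ_pi fun k => isCompact_Icc
  obtain ⟨L, -, φ, hφ, hL⟩ := hcomp.tendsto_subseq
    (x := fun n k => dist (z n) (s k n) / r n)
    (fun n k _ => ⟨div_nonneg dist_nonneg (hr.1 n).le, hC k n⟩)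
  rw [tendsto_pi_nhds] at hL
  have hzst : ∀ u ∈ F, MutuallyStable (r ∘ φ) (z ∘ φ) (u ∘ φ) := by
    intro u hu
    apply tendsto_of_approx
    intro ε hε
    obtain ⟨k, hk⟩ := he.exists_dist_lt (π u) hε
    refine ⟨fun n => dist (z (φ n)) (s k (φ n)) / r (φ n), ⟨L k, hL k⟩, ?_⟩
    have hus := hdist u hu _ (hsF k)
    rw [hs] at hus
    filter_upwards [(hus.comp hφ.tendsto_atTop).eventually_lt_const hk] with n hn
    have := approx_dist (hr.1 (φ n)) (u (φ n)) (s k (φ n)) (z (φ n))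
    simp only [Function.comp] at hn ⊢
    rw [dist_comm (z (φ n)), dist_comm (z (φ n))]
    exact this.trans hn.le
  have hG : SelfStable (r ∘ φ) (insert (z ∘ φ) ((fun u => u ∘ φ) '' F)) := by
    rintro u (rfl | ⟨u, hu, rfl⟩) v (rfl | ⟨v, hv, rfl⟩)
    · exact ⟨0, by simp⟩
    · exact hzst v hv
    · obtain ⟨L, hL⟩ := hzst u hu
      exact ⟨L, by simpa only [dist_comm] using hL⟩
    · exact ⟨_, (hdist u hu v hv).comp hφ.tendsto_atTop⟩
  obtain ⟨F', hF', hsub⟩ := exists_maximal (p := p) hG (Or.inr ⟨_, hF.2.1, rfl⟩)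
  obtain ⟨m, hm, hmz⟩ := hT φ hφ F' hF' (fun u hu => hsub (Or.inr ⟨u, hu, rfl⟩)) (z ∘ φ)
    (hsub (Or.inl rfl))
  have hfin : ∀ u ∈ F, Tendsto (fun n => dist (u n) (z n) / r n) atTop
      (𝓝 (dist (π x) (π y) / 2)) → dist (π u) (π m) = dist (π x) (π y) / 2 := by
    intro u hu huz
    have h1 := (hdist u hu m hm).comp hφ.tendsto_atTop
    have h2 := huz.comp hφ.tendsto_atTop
    have h3 : Tendsto (fun n => dist (u (φ n)) (m (φ n)) / r (φ n) -
        dist (u (φ n)) (z (φ n)) / r (φ n)) atTop (𝓝 0) := by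
      refine squeeze_zero_norm (fun n => ?_) hmz
      rw [Real.norm_eq_abs, dist_comm (u (φ n)), dist_comm (u (φ n))]
      exact approx_dist (hr.1 (φ n)) _ _ _
    have h4 := tendsto_nhds_unique h3 (h1.sub h2)
    linarith
  exact ⟨π m, hfin x hxF hxz, hfin y hyF hyz⟩

end Helpers

/-- if `X` is midpoint convex at `p` and
`liminf_{w,x,y,z → p} A₂ ≥ 0`, then every separable tangent space is a complete
geodesic space satisfying the Lebedeva–Petrunin inequality (hence a space of
nonnegative Aleksandrov curvature). -/
theorem separable_tangent_space_nonneg_curvature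
    {X : Type u} [MetricSpace X] (p : X)
    (hmid : MidpointConvexAt p)
    (hA2 : 0 ≤ liminf (fun q : X × X × X × X => A2 p q.1 q.2.1 q.2.2.1 q.2.2.2)
        (𝓝 (p, p, p, p))) :
    ∀ (r : ℕ → ℝ) (F : Set (ℕ → X)) (Ω : Type u) [MetricSpace Ω]
      (π : (ℕ → X) → Ω), IsPretangentSpace p r F π → IsTangentFamily p r F →
      TopologicalSpace.SeparableSpace Ω →
      CompleteSpace Ω ∧ IsGeodesicSpace Ω ∧
        ∀ α β γ η : Ω, (dist α β ^ 2 + dist β γ ^ 2 + dist γ α ^ 2) / 3 ≤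
          dist η α ^ 2 + dist η β ^ 2 + dist η γ ^ 2 := by
  intro r F Ω _ π hP hT hsep
  have hc : CompleteSpace Ω := complete_pretangent hP
  refine ⟨hc, geodesic_of_midpoints (midpoint_tangent hmid hP hT hsep), ?_⟩
  obtain ⟨hr, hF, hsurj, hdist⟩ := hP
  intro α β γ η
  obtain ⟨x, hx, rfl⟩ := hsurj α
  obtain ⟨y, hy, rfl⟩ := hsurj β
  obtain ⟨z, hz, rfl⟩ := hsurj γ
  obtain ⟨w, hw, rfl⟩ := hsurj η
  have hp := hF.2.1
  exact LP_ineq hA2 hr (hdist w hw _ hp) (hdist x hx _ hp) (hdist y hy _ hp) (hdist z hz _ hp)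
    (hdist w hw x hx) (hdist w hw y hy) (hdist w hw z hz) (hdist x hx y hy) (hdist y hy z hz)
    (hdist z hz x hx)
end

section
/- Let (X,d) be a metric space with marked point p. If every pretangent space Ω_{p,r̃}^X is a complete geodesic metric space whose metric ρ satisfies (1/3)(ρ²(α,β)+ρ²(β,γ)+ρ²(γ,α)) ≤ ρ²(η,α)+ρ²(η,β)+ρ²(η,γ) for all α,β,γ,η (i.e., every pretangent space is a complete geodesic space of nonnegative Aleksandrov curvature), then X is midpoint convex at p and liminf_{w,x,y,z→p} A₂(w,x,y,z) ≥ 0. -/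
open Filter Topology

universe u

theorem exists_maximal_selfStable {X : Type u} [MetricSpace X] (p : X) (r : ℕ → ℝ)
    (S : Set (ℕ → X)) (hS : SelfStable r S) (hp : (fun _ => p) ∈ S) :
    ∃ F, S ⊆ F ∧ MaximalSelfStable p r F := by
  obtain ⟨F, hSF, hF⟩ := zorn_subset_nonempty {G : Set (ℕ → X) | SelfStable r G}
    (by
      intro c hc hch hne
      refine ⟨⋃₀ c, ?_, fun s hs => Set.subset_sUnion_of_mem hs⟩
      rintro x ⟨a, ha, hxa⟩ y ⟨b, hb, hyb⟩
      rcases hch.total ha hb with hab | hab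
      · exact hc hb x (hab hxa) y hyb
      · exact hc ha x hxa y (hab hyb)) S hS
  refine ⟨F, hSF, hF.prop, hSF hp, fun G hG hFG => ?_⟩
  exact Set.Subset.antisymm (hF.le_of_ge hG hFG) hFG

theorem exists_metric_quotient {T : Type u} (L : T → T → ℝ) (h0 : ∀ x, L x x = 0)
    (hc : ∀ x y, L x y = L y x) (ht : ∀ x y z, L x z ≤ L x y + L y z) :
    ∃ (Ω : Type u) (_ : MetricSpace Ω) (f : T → Ω), Function.Surjective f ∧
      ∀ x y, dist (f x) (f y) = L x y := by
  let _ : PseudoMetricSpace T :=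
    { dist := L
      dist_self := h0
      dist_comm := hc
      dist_triangle := ht }
  exact ⟨SeparationQuotient T, inferInstance, SeparationQuotient.mk,
    SeparationQuotient.surjective_mk, fun x y => SeparationQuotient.dist_mk x y⟩

theorem exists_pretangent {X : Type u} [MetricSpace X] (p : X) (r : ℕ → ℝ)
    (hr : IsNormalizingSeq r) (F : Set (ℕ → X)) (hF : MaximalSelfStable p r F) :
    ∃ (Ω : Type u) (_ : MetricSpace Ω) (π : (ℕ → X) → Ω), IsPretangentSpace p r F π := by
  classical
  choose L hL using fun (x y : F) => hF.1 x.1 x.2 y.1 y.2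
  obtain ⟨Ω, m, f, hf, hd⟩ := exists_metric_quotient L
    (fun x => by
      refine tendsto_nhds_unique (hL x x) ?_
      simp)
    (fun x y => by
      refine tendsto_nhds_unique (hL x y) ?_
      simpa only [dist_comm] using hL y x)
    (fun x y z => by
      refine le_of_tendsto_of_tendsto' (hL x z) ((hL x y).add (hL y z)) fun n => ?_
      rw [← add_div]
      exact div_le_div_of_nonneg_right (dist_triangle _ _ _) (hr.1 n).le)
  refine ⟨Ω, m, fun x => if hx : x ∈ F then f ⟨x, hx⟩ else f ⟨_, hF.2.1⟩, hr, hF, ?_, ?_⟩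
  · intro ω
    obtain ⟨x, rfl⟩ := hf ω
    exact ⟨x.1, x.2, by simp⟩
  · intro x hx y hy
    simp only [hx, hy, dif_pos, hd]
    exact hL ⟨x, hx⟩ ⟨y, hy⟩

theorem exists_pretangent_subseq {X : Type u} [MetricSpace X] (p : X) (r : ℕ → ℝ)
    (hr : IsNormalizingSeq r) {k : ℕ} (s : Fin k → ℕ → X) (i₀ : Fin k)
    (hi₀ : s i₀ = fun _ => p) (hs : ∀ i n, dist (s i n) p ≤ r n) :
    ∃ φ : ℕ → ℕ, StrictMono φ ∧ ∃ (F : Set (ℕ → X)) (Ω : Type u) (_ : MetricSpace Ω)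
      (π : (ℕ → X) → Ω), IsPretangentSpace p (r ∘ φ) F π ∧ ∀ i, s i ∘ φ ∈ F := by
  have hcomp : IsCompact (Set.univ.pi fun _ : Fin k × Fin k => Set.Icc (0:ℝ) 2) :=
    isCompact_univ_pi fun _ => isCompact_Icc
  obtain ⟨l, -, φ, hφ, hl⟩ := hcomp.tendsto_subseq
    (x := fun n (q : Fin k × Fin k) => dist (s q.1 n) (s q.2 n) / r n) (by
      intro n q _
      refine ⟨div_nonneg dist_nonneg (hr.1 n).le, ?_⟩
      rw [div_le_iff₀ (hr.1 n)]
      have := dist_triangle_right (s q.1 n) (s q.2 n) p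
      have h1 := hs q.1 n
      have h2 := hs q.2 n
      linarith)
  have hl' := tendsto_pi_nhds.1 hl
  have hr' : IsNormalizingSeq (r ∘ φ) := ⟨fun n => hr.1 _, hr.2.comp hφ.tendsto_atTop⟩
  obtain ⟨F, hSF, hF⟩ := exists_maximal_selfStable p (r ∘ φ) (Set.range fun i => s i ∘ φ)
    (by
      rintro _ ⟨i, rfl⟩ _ ⟨j, rfl⟩
      exact ⟨l (i, j), hl' (i, j)⟩)
    ⟨i₀, by simp only [hi₀]; rfl⟩
  obtain ⟨Ω, m, π, hπ⟩ := exists_pretangent p _ hr' F hF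
  exact ⟨φ, hφ, F, Ω, m, π, hπ, fun i => hSF ⟨i, rfl⟩⟩

/-- The common denominator-normalized midpoint defect. -/
noncomputable def midDefect {X : Type u} [MetricSpace X] (p x y z : X) : ℝ :=
  max |dist x z - dist x y / 2| |dist y z - dist x y / 2| / max (dist x p) (dist y p)

theorem midDefect_nonneg {X : Type u} [MetricSpace X] (p x y z : X) :
    0 ≤ midDefect p x y z := by
  unfold midDefect; positivity

theorem eventually_exists_midDefect_lt {X : Type u} [MetricSpace X] (p : X)
    (h : ∀ (r : ℕ → ℝ) (F : Set (ℕ → X)) (Ω : Type u) [MetricSpace Ω]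
      (π : (ℕ → X) → Ω), IsPretangentSpace p r F π → IsGeodesicSpace Ω)
    (x y : ℕ → X) (hx : Tendsto x atTop (𝓝 p)) (hy : Tendsto y atTop (𝓝 p))
    (ε : ℝ) (hε : 0 < ε) : ∀ᶠ n in atTop, ∃ z, midDefect p (x n) (y n) z < ε := by
  by_contra hcon
  obtain ⟨ns, hns, hbad⟩ := exists_seq_forall_of_frequently (not_eventually.1 hcon)
  push Not at hbad
  set r : ℕ → ℝ := fun n => max (dist (x (ns n)) p) (dist (y (ns n)) p) with hrdef
  have hr : IsNormalizingSeq r := by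
    constructor
    · intro n
      by_contra h0
      have h0' : r n = 0 := le_antisymm (not_lt.1 h0) (by simp only [hrdef]; positivity)
      have := hbad n p
      unfold midDefect at this
      change max (dist (x (ns n)) p) (dist (y (ns n)) p) = 0 at h0'
      rw [h0', div_zero] at this
      linarith
    · have h1 := (tendsto_iff_dist_tendsto_zero.1 (hx.comp hns))
      have h2 := (tendsto_iff_dist_tendsto_zero.1 (hy.comp hns))
      simpa using h1.max h2
  obtain ⟨φ, hφ, F, Ω, m, π, hπ, hmem⟩ := exists_pretangent_subseq p r hr
    ![x ∘ ns, y ∘ ns, fun _ => p] 2 rfl (by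
      intro i n
      fin_cases i
      · exact le_max_left _ _
      · exact le_max_right _ _
      · simpa using (hr.1 n).le)
  have hxF : (x ∘ ns) ∘ φ ∈ F := hmem 0
  have hyF : (y ∘ ns) ∘ φ ∈ F := hmem 1
  obtain ⟨sg, f, hf, -, hf0, hf1⟩ := h _ _ _ π hπ (π ((x ∘ ns) ∘ φ)) (π ((y ∘ ns) ∘ φ))
  set D := dist (π ((x ∘ ns) ∘ φ)) (π ((y ∘ ns) ∘ φ)) with hD
  have hD0 : 0 ≤ D := dist_nonneg
  obtain ⟨z, hzF, hz⟩ := hπ.2.2.1 (f (D / 2))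
  have e1 : dist (π ((x ∘ ns) ∘ φ)) (π z) = D / 2 := by
    rw [hz]
    nth_rewrite 1 [← hf0]
    rw [hf 0 ⟨le_rfl, hD0⟩ (D/2) ⟨by linarith, by linarith⟩, zero_sub, abs_neg,
      abs_of_nonneg (by linarith)]
  have e2 : dist (π ((y ∘ ns) ∘ φ)) (π z) = D / 2 := by
    rw [hz]
    nth_rewrite 1 [← hf1]
    rw [hf D ⟨hD0, le_rfl⟩ (D/2) ⟨by linarith, by linarith⟩, abs_of_nonneg (by linarith)]
    ring
  have t0 := hπ.2.2.2 _ hxF _ hyF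
  have t1 := hπ.2.2.2 _ hxF _ hzF
  have t2 := hπ.2.2.2 _ hyF _ hzF
  rw [e1] at t1
  rw [e2] at t2
  rw [← hD] at t0
  have T := ((t1.sub (t0.div_const 2)).abs).max ((t2.sub (t0.div_const 2)).abs)
  simp only [sub_self, abs_zero, max_self] at T
  obtain ⟨n, hn⟩ := (T.eventually (gt_mem_nhds hε)).exists
  have hb := hbad (φ n) (z n)
  have hrp := hr.1 (φ n)
  refine absurd hn (not_lt.2 (hb.trans (le_of_eq ?_)))
  unfold midDefect
  change max _ _ / r (φ n) = _
  rw [← max_div_div_right hrp.le]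
  simp only [Function.comp]
  congr 1
  · rw [← abs_of_pos hrp, ← abs_div, abs_of_pos hrp]
    congr 1; ring
  · rw [← abs_of_pos hrp, ← abs_div, abs_of_pos hrp]
    congr 1; ring

theorem midpointConvexAt_of_geodesic {X : Type u} [MetricSpace X] (p : X)
    (h : ∀ (r : ℕ → ℝ) (F : Set (ℕ → X)) (Ω : Type u) [MetricSpace Ω]
      (π : (ℕ → X) → Ω), IsPretangentSpace p r F π → IsGeodesicSpace Ω) :
    MidpointConvexAt p := by
  classical
  intro x y hx hy
  have hb : ∀ n, BddBelow (Set.range (midDefect p (x n) (y n))) := fun n =>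
    ⟨0, by rintro _ ⟨z, rfl⟩; exact midDefect_nonneg _ _ _ _⟩
  have : Nonempty X := ⟨p⟩
  have hch : ∀ n : ℕ, ∃ z, midDefect p (x n) (y n) z <
      (⨅ z, midDefect p (x n) (y n) z) + 1 / ((n : ℝ) + 1) := fun n =>
    exists_lt_of_ciInf_lt (lt_add_of_pos_right _ (by positivity))
  choose z₀ hz₀ using hch
  set z : ℕ → X := fun n => if x n = p ∧ y n = p then p else z₀ n with hzdef
  have hlim : Tendsto (fun n => midDefect p (x n) (y n) (z n)) atTop (𝓝 0) := by
    rw [Metric.tendsto_atTop']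
    intro ε hε
    have h1 := eventually_exists_midDefect_lt p h x y hx hy (ε / 2) (by linarith)
    have h2 : ∀ᶠ n : ℕ in atTop, 1 / ((n : ℝ) + 1) < ε / 2 :=
      tendsto_one_div_add_atTop_nhds_zero_nat.eventually (gt_mem_nhds (by linarith))
    obtain ⟨N, hN⟩ := eventually_atTop.1 (h1.and h2)
    refine ⟨N, fun n hn => ?_⟩
    obtain ⟨⟨w, hw⟩, hn2⟩ := hN n hn.le
    rw [Real.dist_0_eq_abs, abs_of_nonneg (midDefect_nonneg _ _ _ _)]
    by_cases hc : x n = p ∧ y n = p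
    · simp [midDefect, hc.1, hc.2, hε]
    · have : z n = z₀ n := by simp only [hzdef, if_neg hc]
      rw [this]
      have := hz₀ n
      have := ciInf_le (hb n) w
      linarith
  have hq : ∀ n w, midQuot p w (x n) (y n) (z n) =
      ((|dist w (z n) - dist (x n) (y n) / 2| / max (dist (x n) p) (dist (y n) p) : ℝ) : EReal) := by
    intro n w
    unfold midQuot
    by_cases hc : x n = p ∧ y n = p
    · have : z n = p := by simp only [hzdef, if_pos hc]
      simp [this, hc.1, hc.2]
    · rw [if_neg hc]
  refine ⟨z, ?_, ?_⟩
  · simp only [hq]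
    rw [← EReal.coe_zero, EReal.tendsto_coe]
    refine squeeze_zero (fun n => by positivity) (fun n => ?_) hlim
    exact div_le_div_of_nonneg_right (le_max_left _ _) (by positivity)
  · simp only [hq]
    rw [← EReal.coe_zero, EReal.tendsto_coe]
    refine squeeze_zero (fun n => by positivity) (fun n => ?_) hlim
    exact div_le_div_of_nonneg_right (le_max_right _ _) (by positivity)

theorem A2_le {X : Type u} [MetricSpace X] (p w x y z : X) : A2 p w x y z ≤ 12 := by
  unfold A2
  split_ifs with hc
  · norm_num
  set δ := delta4 p w x y z with hδ
  have hw : dist w p ≤ δ := le_max_left _ _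
  have hx : dist x p ≤ δ := (le_max_left _ _).trans (le_max_right _ _)
  have hy : dist y p ≤ δ :=
    ((le_max_left _ _).trans (le_max_right _ _)).trans (le_max_right _ _)
  have hz : dist z p ≤ δ :=
    ((le_max_right _ _).trans (le_max_right _ _)).trans (le_max_right _ _)
  have hδ0 : 0 ≤ δ := dist_nonneg.trans hw
  refine div_le_of_le_mul₀ (by positivity) (by norm_num) ?_
  have key : ∀ a b : X, dist a p ≤ δ → dist b p ≤ δ → dist a b ^ 2 ≤ 4 * δ ^ 2 := by
    intro a b ha hb
    have h1 : dist a b ≤ 2 * δ := (dist_triangle_right a b p).trans (by linarith)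
    have h2 : 0 ≤ dist a b := dist_nonneg
    nlinarith
  have := key w x hw hx
  have := key w y hw hy
  have := key w z hw hz
  have := sq_nonneg (dist x y)
  have := sq_nonneg (dist y z)
  have := sq_nonneg (dist z x)
  linarith

theorem eventually_A2_ge {X : Type u} [MetricSpace X] (p : X)
    (h : ∀ (r : ℕ → ℝ) (F : Set (ℕ → X)) (Ω : Type u) [MetricSpace Ω]
      (π : (ℕ → X) → Ω), IsPretangentSpace p r F π →
        ∀ α β γ η : Ω, (dist α β ^ 2 + dist β γ ^ 2 + dist γ α ^ 2) / 3 ≤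
          dist η α ^ 2 + dist η β ^ 2 + dist η γ ^ 2)
    (ε : ℝ) (hε : 0 < ε) : ∀ᶠ q : X × X × X × X in 𝓝 (p, p, p, p),
      -ε ≤ A2 p q.1 q.2.1 q.2.2.1 q.2.2.2 := by
  by_contra hcon
  obtain ⟨q, hq, hbad⟩ := exists_seq_forall_of_frequently (not_eventually.1 hcon)
  push Not at hbad
  obtain ⟨w, hw⟩ : ∃ w : ℕ → X, w = fun n => (q n).1 := ⟨_, rfl⟩
  obtain ⟨x, hx⟩ : ∃ w : ℕ → X, w = fun n => (q n).2.1 := ⟨_, rfl⟩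
  obtain ⟨y, hy⟩ : ∃ w : ℕ → X, w = fun n => (q n).2.2.1 := ⟨_, rfl⟩
  obtain ⟨z, hz⟩ : ∃ w : ℕ → X, w = fun n => (q n).2.2.2 := ⟨_, rfl⟩
  have hwt : Tendsto w atTop (𝓝 p) := by
    rw [hw]; exact (continuous_fst.tendsto (p, p, p, p)).comp hq
  have hxt : Tendsto x atTop (𝓝 p) := by
    rw [hx]; exact ((continuous_fst.comp continuous_snd).tendsto (p, p, p, p)).comp hq
  have hyt : Tendsto y atTop (𝓝 p) := by
    rw [hy]
    exact ((continuous_fst.comp (continuous_snd.comp continuous_snd)).tendsto (p, p, p, p)).comp hq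
  have hzt : Tendsto z atTop (𝓝 p) := by
    rw [hz]
    exact ((continuous_snd.comp (continuous_snd.comp continuous_snd)).tendsto (p, p, p, p)).comp hq
  have hbad' : ∀ n, A2 p (w n) (x n) (y n) (z n) < -ε := by
    intro n; rw [hw, hx, hy, hz]; exact hbad n
  have hne : ∀ n, ¬ (w n = p ∧ x n = p ∧ y n = p ∧ z n = p) := by
    intro n hc
    have := hbad' n
    rw [A2, if_pos hc] at this
    linarith
  set r : ℕ → ℝ := fun n => delta4 p (w n) (x n) (y n) (z n) with hr_def
  have lw : ∀ n, dist (w n) p ≤ r n := fun n => le_max_left _ _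
  have lx : ∀ n, dist (x n) p ≤ r n := fun n => (le_max_left _ _).trans (le_max_right _ _)
  have ly : ∀ n, dist (y n) p ≤ r n := fun n =>
    ((le_max_left _ _).trans (le_max_right _ _)).trans (le_max_right _ _)
  have lz : ∀ n, dist (z n) p ≤ r n := fun n =>
    ((le_max_right _ _).trans (le_max_right _ _)).trans (le_max_right _ _)
  have hr : IsNormalizingSeq r := by
    constructor
    · intro n
      by_contra h0
      have h0 := not_lt.1 h0
      exact hne n ⟨dist_le_zero.1 ((lw n).trans h0), dist_le_zero.1 ((lx n).trans h0),
        dist_le_zero.1 ((ly n).trans h0), dist_le_zero.1 ((lz n).trans h0)⟩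
    · simpa [hr_def, delta4] using (tendsto_iff_dist_tendsto_zero.1 hwt).max
        ((tendsto_iff_dist_tendsto_zero.1 hxt).max
          ((tendsto_iff_dist_tendsto_zero.1 hyt).max (tendsto_iff_dist_tendsto_zero.1 hzt)))
  obtain ⟨φ, hφ, F, Ω, m, π, hπ, hmem⟩ := exists_pretangent_subseq p r hr
    ![w, x, y, z, fun _ => p] 4 rfl (by
      intro i n
      fin_cases i
      · exact lw n
      · exact lx n
      · exact ly n
      · exact lz n
      · simpa using (hr.1 n).le)
  have hwF : w ∘ φ ∈ F := hmem 0
  have hxF : x ∘ φ ∈ F := hmem 1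
  have hyF : y ∘ φ ∈ F := hmem 2
  have hzF : z ∘ φ ∈ F := hmem 3
  have hineq := h _ _ _ π hπ (π (x ∘ φ)) (π (y ∘ φ)) (π (z ∘ φ)) (π (w ∘ φ))
  have T := ((((hπ.2.2.2 _ hwF _ hxF).pow 2).add ((hπ.2.2.2 _ hwF _ hyF).pow 2)).add
    ((hπ.2.2.2 _ hwF _ hzF).pow 2)).sub
    (((((hπ.2.2.2 _ hxF _ hyF).pow 2).add ((hπ.2.2.2 _ hyF _ hzF).pow 2)).add
    ((hπ.2.2.2 _ hzF _ hxF).pow 2)).div_const 3)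
  have hle := le_of_tendsto' T (b := -ε) (fun n => by
    have hb := hbad' (φ n)
    rw [A2, if_neg (hne _)] at hb
    change _ / r (φ n) ^ 2 < _ at hb
    refine le_trans (le_of_eq ?_) hb.le
    have := (hr.1 (φ n)).ne'
    simp only [Function.comp]
    field_simp)
  linarith

/-- if every pretangent space is a complete geodesic space
satisfying the Lebedeva–Petrunin inequality (i.e. is a complete geodesic space
of nonnegative Aleksandrov curvature), then `X` is midpoint convex at `p` and
`liminf_{w,x,y,z → p} A₂ ≥ 0`. -/
theorem midpointConvex_and_liminf_A2_of_pretangent_nonneg_curvature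
    {X : Type u} [MetricSpace X] (p : X)
    (h : ∀ (r : ℕ → ℝ) (F : Set (ℕ → X)) (Ω : Type u) [MetricSpace Ω]
      (π : (ℕ → X) → Ω), IsPretangentSpace p r F π →
      CompleteSpace Ω ∧ IsGeodesicSpace Ω ∧
        ∀ α β γ η : Ω, (dist α β ^ 2 + dist β γ ^ 2 + dist γ α ^ 2) / 3 ≤
          dist η α ^ 2 + dist η β ^ 2 + dist η γ ^ 2) :
    MidpointConvexAt p ∧
      0 ≤ liminf (fun q : X × X × X × X => A2 p q.1 q.2.1 q.2.2.1 q.2.2.2)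
          (𝓝 (p, p, p, p)) := by
  refine ⟨midpointConvexAt_of_geodesic p fun r F Ω _ π hπ => (h r F Ω π hπ).2.1, ?_⟩
  refine le_of_forall_pos_le_add fun ε hε => ?_
  have h1 : -ε ≤ liminf (fun q : X × X × X × X => A2 p q.1 q.2.1 q.2.2.1 q.2.2.2)
      (𝓝 (p, p, p, p)) := by
    refine le_liminf_of_le ?_
      (eventually_A2_ge p (fun r F Ω _ π hπ => (h r F Ω π hπ).2.2) ε hε)
    exact IsBoundedUnder.isCoboundedUnder_ge
      (isBoundedUnder_of ⟨12, fun q => A2_le _ _ _ _ _⟩)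
  linarith
end
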